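/- arXiv:1202.5896 — 3 statements merged into one kernel-verified Lean document; each statement's English description precedes it below -/
import Mathlib

section
/- Let f̃, h ∈ ℂ[X] with deg f̃ ≥ 2 and deg h ≥ 2, let f = f̃ ∘ h, and assume the critical values of f̃ and h do not merge. If f = f₁ ∘ h₁ for some nonconstant polynomials f₁, h₁ ∈ ℂ[X], then there exists a polynomial w ∈ ℂ[X] such that either h₁ = w ∘ h or h = w ∘ h₁. -/
open Polynomial

/-- The critical values of `f̃` and `h` do not merge in the composition `f = f̃ ∘ h`:
(i) no critical value of `f̃` (as value of `f`) coincides with a critical value coming from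
a critical point of `h`, and (ii) `f̃` is injective on the set of critical values of `h`. -/
def CriticalValuesDoNotMerge (ftilde h : Polynomial ℂ) : Prop :=
  (¬ ∃ a b : ℂ, (Polynomial.derivative ftilde).eval (h.eval a) = 0 ∧
      (Polynomial.derivative h).eval b = 0 ∧
      (ftilde.comp h).eval a = (ftilde.comp h).eval b) ∧
  (∀ b b' : ℂ, (Polynomial.derivative h).eval b = 0 →
      (Polynomial.derivative h).eval b' = 0 →
      ftilde.eval (h.eval b) = ftilde.eval (h.eval b') → h.eval b = h.eval b')


/-- The field of formal Laurent series, where `X` plays the role of a local parameter at infinity. -/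
abbrev SeriesField : Type := FractionRing (PowerSeries ℂ)

/-- `HasLead a k c` says that `a = X⁻ᵏ (c + O(X))`. -/
def HasLead (a : SeriesField) (k : ℕ) (c : ℂ) : Prop :=
  ∃ o : PowerSeries ℂ, algebraMap (PowerSeries ℂ) SeriesField o =
    algebraMap (PowerSeries ℂ) SeriesField PowerSeries.X ^ k * a ∧ PowerSeries.constantCoeff o = c

theorem HasLead.const (c : ℂ) : HasLead (algebraMap ℂ SeriesField c) 0 c :=
  ⟨PowerSeries.C c, by
    rw [pow_zero, one_mul, IsScalarTower.algebraMap_apply ℂ (PowerSeries ℂ) SeriesField]; rfl,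
    by simp⟩

theorem HasLead.mul {a b : SeriesField} {k l : ℕ} {c d : ℂ} (ha : HasLead a k c)
    (hb : HasLead b l d) : HasLead (a * b) (k + l) (c * d) := by
  obtain ⟨o, ho, rfl⟩ := ha
  obtain ⟨o', ho', rfl⟩ := hb
  exact ⟨o * o', by rw [map_mul, ho, ho']; ring, by simp⟩

theorem HasLead.prod {ι : Type*} (s : Finset ι) {a : ι → SeriesField} {k : ℕ} {c : ι → ℂ}
    (h : ∀ i ∈ s, HasLead (a i) k (c i)) :
    HasLead (∏ i ∈ s, a i) (s.card * k) (∏ i ∈ s, c i) := by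
  classical
  induction s using Finset.induction_on with
  | empty => simpa using HasLead.const 1
  | insert i s hi ih =>
    rw [Finset.prod_insert hi, Finset.prod_insert hi, Finset.card_insert_of_notMem hi, add_mul,
      one_mul, add_comm]
    exact (h i (Finset.mem_insert_self _ _)).mul
      (ih fun j hj => h j (Finset.mem_insert_of_mem hj))

theorem algebraMap_X_ne_zero :
    algebraMap (PowerSeries ℂ) SeriesField PowerSeries.X ≠ 0 := by
  rw [Ne, FaithfulSMul.algebraMap_eq_zero_iff]
  exact PowerSeries.X_ne_zero

theorem HasLead.coeff_unique {a : SeriesField} {k : ℕ} {c d : ℂ} (ha : HasLead a k c)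
    (hb : HasLead a k d) : c = d := by
  obtain ⟨o, ho, rfl⟩ := ha
  obtain ⟨o', ho', rfl⟩ := hb
  rw [FaithfulSMul.algebraMap_injective _ _ (ho.trans ho'.symm)]

theorem HasLead.eq_zero_of_lt {a : SeriesField} {k l : ℕ} {c d : ℂ} (ha : HasLead a k c)
    (hb : HasLead a l d) (hkl : k < l) : d = 0 := by
  obtain ⟨o, ho, rfl⟩ := ha
  obtain ⟨o', ho', rfl⟩ := hb
  have : o' = PowerSeries.X ^ (l - k) * o := by
    apply FaithfulSMul.algebraMap_injective (PowerSeries ℂ) SeriesField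
    rw [ho', map_mul, ho, map_pow, ← mul_assoc, ← pow_add, Nat.sub_add_cancel hkl.le]
  rw [this]
  simp [Nat.sub_ne_zero_of_lt hkl]

theorem HasLead.order_unique {a : SeriesField} {k l : ℕ} {c d : ℂ} (ha : HasLead a k c)
    (hb : HasLead a l d) (hc : c ≠ 0) (hd : d ≠ 0) : k = l := by
  rcases lt_trichotomy k l with h | h | h
  · exact absurd (ha.eq_zero_of_lt hb h) hd
  · exact h
  · exact absurd (hb.eq_zero_of_lt ha h) hc

theorem HasLead.aeval {a : SeriesField} {ζ : ℂ} (ha : HasLead a 1 ζ) (p : ℂ[X]) :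
    HasLead (Polynomial.aeval a p) p.natDegree (p.leadingCoeff * ζ ^ p.natDegree) := by
  obtain ⟨y, hy, rfl⟩ := ha
  refine ⟨∑ i ∈ Finset.range (p.natDegree + 1),
    PowerSeries.C (p.coeff i) * y ^ i * PowerSeries.X ^ (p.natDegree - i), ?_, ?_⟩
  · rw [Polynomial.aeval_eq_sum_range, Finset.mul_sum, map_sum]
    refine Finset.sum_congr rfl fun i hi => ?_
    have hi' : i ≤ p.natDegree := Nat.lt_succ_iff.mp (Finset.mem_range.mp hi)
    rw [map_mul, map_mul, map_pow, map_pow, hy, Algebra.smul_def,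
      IsScalarTower.algebraMap_apply ℂ (PowerSeries ℂ) SeriesField]
    conv_rhs => rw [← Nat.sub_add_cancel hi', pow_add]
    rw [show algebraMap ℂ (PowerSeries ℂ) (p.coeff i) = PowerSeries.C (p.coeff i) from rfl]
    ring
  · rw [map_sum, Finset.sum_range_succ, Finset.sum_eq_zero]
    · simp
    · intro i hi
      have := Nat.sub_ne_zero_of_lt (Finset.mem_range.mp hi)
      simp [this]

/-- Formal Puiseux branches at infinity: `z ζ`, for `ζ ^ deg f = 1`, are solutions of
`f (z ζ) = f (z 1)` with leading coefficient `ζ`. -/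
structure IsBranches (f : ℂ[X]) (z : ℂ → SeriesField) : Prop where
  lead : ∀ ζ : ℂ, ζ ^ f.natDegree = 1 → HasLead (z ζ) 1 ζ
  aeval_eq : ∀ ζ : ℂ, ζ ^ f.natDegree = 1 → aeval (z ζ) f = aeval (z 1) f

theorem exists_powerSeries_branch (f : ℂ[X]) (hf : 1 ≤ f.natDegree) (ζ : ℂ)
    (hζ : ζ ^ f.natDegree = 1) :
    ∃ a : SeriesField, HasLead a 1 ζ ∧
      aeval a f = aeval (algebraMap (PowerSeries ℂ) SeriesField PowerSeries.X)⁻¹ f := by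
  set N := f.natDegree with hN
  set l := f.leadingCoeff
  have hl : l ≠ 0 := leadingCoeff_ne_zero.mpr (by rintro rfl; simp at hN; omega)
  let c : ℕ → PowerSeries ℂ := fun i => PowerSeries.C (f.coeff i / l) * PowerSeries.X ^ (N - i)
  let G : (PowerSeries ℂ)[X] := X ^ N + ∑ i ∈ Finset.range N, C (c i) * X ^ i
  let G' : (PowerSeries ℂ)[X] := G - C (G.eval 1)
  have hdeg : (∑ i ∈ Finset.range N, C (c i) * X ^ i : (PowerSeries ℂ)[X]).degree < (N : ℕ) := by
    refine (degree_sum_le _ _).trans_lt ((Finset.sup_lt_iff (WithBot.bot_lt_coe _)).mpr ?_)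
    intro i hi
    exact (degree_C_mul_X_pow_le _ _).trans_lt (by exact_mod_cast Finset.mem_range.mp hi)
  have hG' : G'.Monic := by
    have : G' = X ^ N + (∑ i ∈ Finset.range N, C (c i) * X ^ i - C (G.eval 1)) := by
      simp only [G', G]; ring
    rw [this]
    refine monic_X_pow_add ((degree_sub_le _ _).trans_lt (max_lt hdeg ?_))
    exact degree_C_le.trans_lt (by exact_mod_cast hf)
  have hc0 : ∀ i ∈ Finset.range N, PowerSeries.constantCoeff (c i) = 0 := by
    intro i hi
    have := Nat.sub_ne_zero_of_lt (Finset.mem_range.mp hi)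
    simp [c, this]
  have hmap : G'.map PowerSeries.constantCoeff = X ^ N - 1 := by
    have h1 : G.map PowerSeries.constantCoeff = X ^ N := by
      simp only [G, Polynomial.map_add, Polynomial.map_pow, map_X, Polynomial.map_sum,
        Polynomial.map_mul, map_C]
      rw [Finset.sum_eq_zero, add_zero]
      intro i hi
      rw [hc0 i hi]; simp
    have h2 : PowerSeries.constantCoeff (G.eval 1) = 1 := by
      have := Polynomial.eval_map_apply (f := PowerSeries.constantCoeff (R := ℂ)) (p := G) 1
      rw [h1] at this
      simpa using this.symm
    simp only [G', Polynomial.map_sub, h1, map_C, h2, map_one]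
  have hev : ∀ q : (PowerSeries ℂ)[X], PowerSeries.constantCoeff (q.eval (PowerSeries.C ζ)) =
      (q.map PowerSeries.constantCoeff).eval ζ := by
    intro q
    have := Polynomial.eval_map_apply (f := PowerSeries.constantCoeff (R := ℂ)) (p := q)
      (PowerSeries.C ζ)
    simpa using this.symm
  have hζ0 : ζ ≠ 0 := by
    rintro rfl
    rw [zero_pow (by omega)] at hζ
    exact zero_ne_one hζ
  obtain ⟨y, hy, hyζ⟩ := HenselianRing.is_henselian (I := Ideal.span {(PowerSeries.X : PowerSeries ℂ)})
    G' hG' (PowerSeries.C ζ)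
    (by
      rw [Ideal.mem_span_singleton, PowerSeries.X_dvd_iff, hev, hmap]
      simp [hζ])
    (by
      apply IsUnit.map
      rw [PowerSeries.isUnit_iff_constantCoeff, hev, ← derivative_map, hmap]
      simp only [derivative_sub, derivative_X_pow, derivative_one, sub_zero, eval_mul, eval_pow,
        eval_X, isUnit_iff_ne_zero, eval_C]
      exact mul_ne_zero (by exact_mod_cast (by omega)) (pow_ne_zero _ hζ0))
  rw [Ideal.mem_span_singleton, PowerSeries.X_dvd_iff, map_sub, sub_eq_zero] at hyζ
  set w := algebraMap (PowerSeries ℂ) SeriesField PowerSeries.X with hw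
  have hw0 : w ≠ 0 := algebraMap_X_ne_zero
  have key : ∀ s : PowerSeries ℂ, algebraMap (PowerSeries ℂ) SeriesField (G.eval s) *
      algebraMap ℂ SeriesField l = w ^ N * aeval (algebraMap (PowerSeries ℂ) SeriesField s / w) f := by
    intro s
    rw [Polynomial.aeval_eq_sum_range, ← hN, Finset.sum_range_succ]
    simp only [G, eval_add, eval_pow, eval_X, eval_finsetSum, eval_mul, eval_C, map_add, map_sum,
      map_mul, map_pow, c, ← hw, add_mul, mul_add, Finset.sum_mul, Finset.mul_sum]
    rw [add_comm]
    congr 1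
    · refine Finset.sum_congr rfl fun i hi => ?_
      have hi' : i ≤ N := (Finset.mem_range.mp hi).le
      rw [Algebra.smul_def]
      have : algebraMap ℂ SeriesField (f.coeff i) =
          algebraMap (PowerSeries ℂ) SeriesField (PowerSeries.C (f.coeff i / l)) *
          algebraMap ℂ SeriesField l := by
        rw [show PowerSeries.C (f.coeff i / l) = algebraMap ℂ (PowerSeries ℂ) (f.coeff i / l)
          from rfl, ← IsScalarTower.algebraMap_apply, ← map_mul, div_mul_cancel₀ _ hl]
      rw [this, div_pow]
      conv_rhs => rw [← Nat.sub_add_cancel hi', pow_add]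
      field_simp
    · rw [Algebra.smul_def, div_pow]
      field_simp
      rfl
  refine ⟨algebraMap (PowerSeries ℂ) SeriesField y / w, ⟨y, ?_, by simpa using hyζ⟩, ?_⟩
  · rw [pow_one, mul_div_cancel₀ _ hw0]
  · have h1 : G.eval y = G.eval 1 := by
      have : G'.eval y = 0 := hy
      simpa [G', sub_eq_zero] using this
    have h2 := key y
    rw [h1, key 1] at h2
    simpa using (mul_left_cancel₀ (pow_ne_zero _ hw0) h2).symm

theorem exists_isBranches (f : ℂ[X]) (hf : 1 ≤ f.natDegree) : ∃ z, IsBranches f z := by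
  choose! z hz using exists_powerSeries_branch f hf
  exact ⟨z, fun ζ hζ => (hz ζ hζ).1,
    fun ζ hζ => (hz ζ hζ).2.trans (hz 1 (one_pow _)).2.symm⟩


theorem roots_eq_val_of_card {K : Type*} [Field K] {q : K[X]} (hq : q ≠ 0) (T : Finset K)
    (hT : ∀ y ∈ T, q.eval y = 0) (hcard : q.natDegree ≤ T.card) : q.roots = T.val ∧ q.Splits := by
  have hle : T.val ≤ q.roots := (Finset.val_le_iff_val_subset).mpr fun y hy =>
    (mem_roots hq).mpr (hT y hy)
  have heq : T.val = q.roots :=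
    Multiset.eq_of_le_of_card_le hle ((card_roots' q).trans hcard)
  refine ⟨heq.symm, splits_iff_card_roots.mpr (le_antisymm (card_roots' q) ?_)⟩
  rw [← heq]
  exact hcard

theorem map_sub_C_ne_zero {L : Type*} [Field L] [Algebra ℂ L] {p : ℂ[X]} (hp : 1 ≤ p.natDegree)
    (c : L) : (p.map (algebraMap ℂ L) - C c).natDegree = p.natDegree ∧
      p.map (algebraMap ℂ L) - C c ≠ 0 := by
  have h : (p.map (algebraMap ℂ L) - C c).natDegree = p.natDegree := by
    rw [natDegree_sub_C, natDegree_map]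
  refine ⟨h, fun h0 => ?_⟩
  rw [h0, natDegree_zero] at h
  omega

theorem card_nthRootsFinset_complex {k : ℕ} (hk : 1 ≤ k) :
    (nthRootsFinset k (1 : ℂ)).card = k :=
  (Complex.isPrimitiveRoot_exp k (by omega)).card_nthRootsFinset

theorem mem_nthRootsFinset_complex {k : ℕ} (hk : 1 ≤ k) {ζ : ℂ} :
    ζ ∈ nthRootsFinset k (1 : ℂ) ↔ ζ ^ k = 1 :=
  mem_nthRootsFinset (by omega) 1

namespace IsBranches

variable {f : ℂ[X]} {z : ℂ → SeriesField}

theorem injOn (hz : IsBranches f z) {ζ η : ℂ} (hζ : ζ ^ f.natDegree = 1)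
    (hη : η ^ f.natDegree = 1) (h : z ζ = z η) : ζ = η :=
  (hz.lead ζ hζ).coeff_unique (h ▸ hz.lead η hη)

theorem transcendental (hz : IsBranches f z) (hf : 1 ≤ f.natDegree) {ζ : ℂ}
    (hζ : ζ ^ f.natDegree = 1) {p : ℂ[X]} (hp : aeval (z ζ) p = 0) : p = 0 := by
  have h := (hz.lead ζ hζ).aeval p
  rw [hp] at h
  have hζ0 : ζ ≠ 0 := by
    rintro rfl
    rw [zero_pow (by omega)] at hζ
    exact zero_ne_one hζ
  have h0 : HasLead 0 p.natDegree 0 := ⟨0, by simp, by simp⟩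
  have := h.coeff_unique h0
  simpa [hζ0] using this

theorem pow_eq_of_aeval_eq (hz : IsBranches f z) {p : ℂ[X]} (hp : p ≠ 0) {ζ η : ℂ}
    (hζ : ζ ^ f.natDegree = 1) (hη : η ^ f.natDegree = 1)
    (h : aeval (z ζ) p = aeval (z η) p) : ζ ^ p.natDegree = η ^ p.natDegree := by
  have h1 := (hz.lead ζ hζ).aeval p
  rw [h] at h1
  exact mul_left_cancel₀ (leadingCoeff_ne_zero.mpr hp)
    (h1.coeff_unique ((hz.lead η hη).aeval p))

theorem aeval_mul_eq (hz : IsBranches f z) (hf : 1 ≤ f.natDegree) {g p : ℂ[X]}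
    (hfg : f = g.comp p) {η ζ : ℂ} (hη : η ^ f.natDegree = 1) (hζ : ζ ^ p.natDegree = 1) :
    aeval (z (η * ζ)) p = aeval (z η) p := by
  classical
  have hN : f.natDegree = g.natDegree * p.natDegree := by rw [hfg, natDegree_comp]
  have hp : 1 ≤ p.natDegree := by
    rcases Nat.eq_zero_or_pos p.natDegree with h | h
    · rw [h, mul_zero] at hN; omega
    · exact h
  obtain ⟨hqd, hq0⟩ := map_sub_C_ne_zero hp (aeval (z η) p)
  set q := p.map (algebraMap ℂ SeriesField) - C (aeval (z η) p)
  obtain ⟨hFd, hF0⟩ := map_sub_C_ne_zero hf (aeval (z η) f)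
  set F := f.map (algebraMap ℂ SeriesField) - C (aeval (z η) f) with hF
  have hqF : q ∣ F := by
    have := Polynomial.sub_dvd_eval_sub (p.map (algebraMap ℂ SeriesField)) (C (aeval (z η) p))
      ((g.map (algebraMap ℂ SeriesField)).map C)
    rw [eval_map, ← comp, eval_map_apply, ← Polynomial.map_comp, ← hfg, eval_map_algebraMap,
      ← aeval_comp, ← hfg] at this
    exact this
  have hinj : Set.InjOn z (nthRootsFinset f.natDegree (1 : ℂ)) := fun a ha b hb h =>
    hz.injOn ((mem_nthRootsFinset_complex hf).mp ha) ((mem_nthRootsFinset_complex hf).mp hb) h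
  obtain ⟨hFr, hFs⟩ := roots_eq_val_of_card hF0 ((nthRootsFinset f.natDegree (1 : ℂ)).image z)
    (by
      intro y hy
      obtain ⟨a, ha, rfl⟩ := Finset.mem_image.mp hy
      rw [mem_nthRootsFinset_complex hf] at ha
      simp [hF, hz.aeval_eq a ha, hz.aeval_eq η hη])
    (by rw [hFd, Finset.card_image_of_injOn hinj, card_nthRootsFinset_complex hf])
  have hqs : q.Splits := hFs.of_dvd hF0 hqF
  have hqle : q.roots ≤ F.roots := roots.le_of_dvd hF0 hqF
  have hqn : q.roots.Nodup := Multiset.nodup_of_le hqle (hFr ▸ Finset.nodup _)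
  let S := (nthRootsFinset f.natDegree (1 : ℂ)).filter fun a => aeval (z a) p = aeval (z η) p
  have hSr : q.roots.toFinset ⊆ S.image z := by
    intro y hy
    rw [Multiset.mem_toFinset] at hy
    have h1 : y ∈ F.roots := Multiset.mem_of_le hqle hy
    rw [hFr, Finset.mem_val] at h1
    obtain ⟨a, ha, rfl⟩ := Finset.mem_image.mp h1
    refine Finset.mem_image_of_mem z (Finset.mem_filter.mpr ⟨ha, ?_⟩)
    have := (mem_roots hq0).mp hy
    simpa [q, sub_eq_zero] using this
  have hScard : p.natDegree ≤ S.card := by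
    calc p.natDegree = q.roots.toFinset.card := by
          rw [Multiset.toFinset_card_of_nodup hqn, ← hqd]
          exact (splits_iff_card_roots.mp hqs).symm
      _ ≤ (S.image z).card := Finset.card_le_card hSr
      _ ≤ S.card := Finset.card_image_le
  have hη0 : η ≠ 0 := by
    rintro rfl
    rw [zero_pow (by omega)] at hη
    exact zero_ne_one hη
  have hsub : S ⊆ (nthRootsFinset p.natDegree (1 : ℂ)).image (η * ·) := by
    intro a ha
    obtain ⟨ha1, ha2⟩ := Finset.mem_filter.mp ha
    rw [mem_nthRootsFinset_complex hf] at ha1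
    refine Finset.mem_image.mpr ⟨a / η, ?_, mul_div_cancel₀ _ hη0⟩
    rw [mem_nthRootsFinset_complex hp, div_pow,
      hz.pow_eq_of_aeval_eq (by rintro rfl; simp at hp) ha1 hη ha2, div_self (pow_ne_zero _ hη0)]
  have heq := Finset.eq_of_subset_of_card_le hsub
    (Finset.card_image_le.trans ((card_nthRootsFinset_complex hp).le.trans hScard))
  have hmem : η * ζ ∈ S := by
    rw [heq]
    exact Finset.mem_image_of_mem _ ((mem_nthRootsFinset_complex hp).mpr hζ)
  exact (Finset.mem_filter.mp hmem).2

theorem injOn_mul (hz : IsBranches f z) (hf : 1 ≤ f.natDegree) {k : ℕ} (hk : k ∣ f.natDegree)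
    (hk1 : 1 ≤ k) {η : ℂ} (hη : η ^ f.natDegree = 1) :
    Set.InjOn (fun ζ => z (η * ζ)) (nthRootsFinset k (1 : ℂ)) := by
  have hη0 : η ≠ 0 := by
    rintro rfl
    rw [zero_pow (by omega)] at hη
    exact zero_ne_one hη
  obtain ⟨m, hm⟩ := hk
  intro a ha b hb h
  have ha' := (mem_nthRootsFinset_complex hk1).mp ha
  have hb' := (mem_nthRootsFinset_complex hk1).mp hb
  refine mul_left_cancel₀ hη0 (hz.injOn ?_ ?_ h)
  · rw [mul_pow, hη, hm, pow_mul, ha', one_pow, one_mul]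
  · rw [mul_pow, hη, hm, pow_mul, hb', one_pow, one_mul]

theorem roots_eq (hz : IsBranches f z) (hf : 1 ≤ f.natDegree) {g p : ℂ[X]}
    (hfg : f = g.comp p) (hp : 1 ≤ p.natDegree) {η : ℂ} (hη : η ^ f.natDegree = 1) :
    (p.map (algebraMap ℂ SeriesField) - C (aeval (z η) p)).roots =
      (nthRootsFinset p.natDegree (1 : ℂ)).val.map (fun ζ => z (η * ζ)) ∧
    (p.map (algebraMap ℂ SeriesField) - C (aeval (z η) p)).Splits := by
  classical
  have hinj := hz.injOn_mul hf (k := p.natDegree)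
    ⟨g.natDegree, by rw [hfg, natDegree_comp, mul_comm]⟩ hp hη
  obtain ⟨hqd, hq0⟩ := map_sub_C_ne_zero hp (aeval (z η) p)
  rw [← Finset.image_val_of_injOn hinj]
  refine roots_eq_val_of_card hq0 _ ?_ ?_
  · intro y hy
    obtain ⟨a, ha, rfl⟩ := Finset.mem_image.mp hy
    rw [mem_nthRootsFinset_complex hp] at ha
    simp [hz.aeval_mul_eq hf hfg hη ha]
  · rw [hqd, Finset.card_image_of_injOn hinj, card_nthRootsFinset_complex hp]

end IsBranches

theorem exists_eq_sum_X_pow_mul_comp {p : ℂ[X]} (hp : 1 ≤ p.natDegree) (q : ℂ[X]) :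
    ∃ c : ℕ → ℂ[X], q = ∑ j ∈ Finset.range p.natDegree, X ^ j * (c j).comp p := by
  induction h : q.natDegree using Nat.strong_induction_on generalizing q with
  | _ n ih =>
    by_cases hn : n < p.natDegree
    · refine ⟨fun j => C (q.coeff j), ?_⟩
      simp only [C_comp]
      rw [q.as_sum_range' p.natDegree (h ▸ hn)]
      refine Finset.sum_congr rfl fun j _ => ?_
      rw [← as_sum_range' q p.natDegree (h ▸ hn), X_pow_mul, C_mul_X_pow_eq_monomial]
    · have hpos : p ≠ 0 := by rintro rfl; simp at hp
      have hlt : (q / p).natDegree < n := by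
        have hq : 1 ≤ q.natDegree := by omega
        by_cases h0 : q / p = 0
        · rw [h0, natDegree_zero]; omega
        · rw [← h]
          exact natDegree_lt_natDegree h0
            (degree_div_lt (by rintro rfl; simp at hq) (natDegree_pos_iff_degree_pos.mp hp))
      obtain ⟨c, hc⟩ := ih _ hlt _ rfl
      have hr : (q % p).natDegree < p.natDegree := natDegree_mod_lt q (by omega)
      refine ⟨fun j => X * c j + C ((q % p).coeff j), ?_⟩
      conv_lhs => rw [← EuclideanDomain.div_add_mod q p, hc, Finset.mul_sum,
        (q % p).as_sum_range' p.natDegree hr, ← Finset.sum_add_distrib]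
      refine Finset.sum_congr rfl fun j _ => ?_
      rw [← C_mul_X_pow_eq_monomial]
      simp only [add_comp, mul_comp, X_comp, C_comp]
      ring

/-- If `q` takes the value `q x` on sufficiently many points of the fibre of `p` through a generic
point `x`, then `q` is a polynomial in `p`. -/
theorem exists_eq_comp_of_fibre {L : Type*} [Field L] [Algebra ℂ L] {x : L}
    (hx : ∀ r : ℂ[X], aeval x r = 0 → r = 0) {p : ℂ[X]} (hp : 1 ≤ p.natDegree) (q : ℂ[X])
    (T : Finset L) (hT : T.card = p.natDegree) (hpT : ∀ y ∈ T, aeval y p = aeval x p)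
    (hqT : ∀ y ∈ T, aeval y q = aeval x q) : ∃ w : ℂ[X], q = w.comp p := by
  obtain ⟨c, hc⟩ := exists_eq_sum_X_pow_mul_comp hp q
  refine ⟨c 0, ?_⟩
  let r : L[X] := ∑ j ∈ Finset.range p.natDegree, C (aeval (aeval x p) (c j)) * X ^ j -
    C (aeval x q)
  have hdeg : r.degree < T.card := by
    rw [hT]
    refine (degree_sub_le _ _).trans_lt (max_lt ?_ ?_)
    · refine (degree_sum_le _ _).trans_lt ((Finset.sup_lt_iff (WithBot.bot_lt_coe _)).mpr ?_)
      intro i hi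
      exact (degree_C_mul_X_pow_le _ _).trans_lt (by exact_mod_cast Finset.mem_range.mp hi)
    · exact degree_C_le.trans_lt (by exact_mod_cast hp)
  have hr : r = 0 := by
    refine eq_zero_of_degree_lt_of_eval_finset_eq_zero T hdeg fun y hy => ?_
    have h1 : aeval y q = _ := congrArg (aeval y) hc
    simp only [map_sum, map_mul, map_pow, aeval_X, aeval_comp, hpT y hy] at h1
    rw [hqT y hy] at h1
    simp only [r, eval_sub, eval_finsetSum, eval_mul, eval_C, eval_pow, eval_X]
    rw [h1, sub_eq_zero]
    exact Finset.sum_congr rfl fun _ _ => mul_comm _ _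
  have hlt : 0 < p.natDegree := hp
  have h0 : aeval (aeval x p) (c 0) = aeval x q := by
    simpa [r, coeff_X_pow, hlt, sub_eq_zero] using congrArg (fun s => coeff s 0) hr
  rw [← sub_eq_zero]
  apply hx
  rw [map_sub, aeval_comp, h0, sub_self]


/-- The gcd of `h(Y) - h(x)` and `h₁(Y) - h₁(x)` for generic `x` is given by a monic polynomial in
`Y` whose coefficients are polynomials in `x`. -/
theorem exists_generic_gcd {L : Type*} [Field L] [Algebra ℂ L] [DecidableEq L] {h : ℂ[X]}
    (hh : 1 ≤ h.natDegree) (h₁ : ℂ[X]) :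
    ∃ E : ℂ[X][X], E.Monic ∧ ∀ x : L, (∀ r : ℂ[X], aeval x r = 0 → r = 0) → ∃ c : L, c ≠ 0 ∧
      E.map (aeval (R := ℂ) x).toRingHom * C c =
        EuclideanDomain.gcd (h.map (algebraMap ℂ L) - C (aeval x h))
          (h₁.map (algebraMap ℂ L) - C (aeval x h₁)) := by
  classical
  let K := FractionRing ℂ[X]
  let p : ℂ[X] → ℂ[X][X] := fun h => h.map C - C h
  let P : ℂ[X] → K[X] := fun h => (p h).map (algebraMap ℂ[X] K)
  have hpQ : ∀ (x : L) (h : ℂ[X]), (p h).map (aeval (R := ℂ) x).toRingHom =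
      h.map (algebraMap ℂ L) - C (aeval x h) := by
    intro x h
    simp only [p, Polynomial.map_sub, map_C, Polynomial.map_map]
    congr 2
    ext; simp
  have hpdeg : (p h).natDegree = h.natDegree ∧ (p h).leadingCoeff = C h.leadingCoeff := by
    have h1 : (p h).natDegree = h.natDegree := by
      rw [natDegree_sub_C, natDegree_map_eq_of_injective C_injective]
    refine ⟨h1, ?_⟩
    rw [leadingCoeff, h1]
    simp [p, coeff_C, show h.natDegree ≠ 0 by omega]
  have hlc : h.leadingCoeff ≠ 0 := leadingCoeff_ne_zero.mpr (by rintro rfl; simp at hh)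
  have hp0 : p h ≠ 0 := by
    rw [← leadingCoeff_ne_zero, hpdeg.2]
    simpa using hlc
  have hP0 : P h ≠ 0 := (Polynomial.map_ne_zero_iff (FaithfulSMul.algebraMap_injective _ _)).mpr hp0
  have hmonic : (p h * C (C h.leadingCoeff⁻¹)).Monic := by
    rw [Monic, leadingCoeff_mul, hpdeg.2, leadingCoeff_C, ← C_mul, mul_inv_cancel₀ hlc, C_1]
  let D : K[X] := EuclideanDomain.gcd (P h) (P h₁)
  have hD0 : D ≠ 0 := fun h0 => hP0 (EuclideanDomain.gcd_eq_zero_iff.mp h0).1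
  obtain ⟨E, hE⟩ := IsIntegrallyClosed.eq_map_mul_C_of_dvd K hmonic (g := D)
    (by
      rw [Polynomial.map_mul]
      exact (EuclideanDomain.gcd_dvd_left _ _).mul_right _)
  have hEm : E.Monic := by
    have h1 := congrArg leadingCoeff hE
    rw [leadingCoeff_mul, leadingCoeff_C] at h1
    have h2 := mul_right_cancel₀ (leadingCoeff_ne_zero.mpr hD0) (h1.trans (one_mul _).symm)
    rw [leadingCoeff_map_of_injective (FaithfulSMul.algebraMap_injective _ _)] at h2
    exact FaithfulSMul.algebraMap_injective _ K (by rw [h2, map_one])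
  refine ⟨E, hEm, fun x hx => ?_⟩
  have hinj : Function.Injective (aeval (R := ℂ) x).toRingHom :=
    (injective_iff_map_eq_zero _).mpr hx
  let φ : K →+* L := IsFractionRing.lift hinj
  have hφ : φ.comp (algebraMap ℂ[X] K) = (aeval (R := ℂ) x).toRingHom :=
    RingHom.ext fun a => IsFractionRing.lift_algebraMap hinj a
  refine ⟨φ D.leadingCoeff, by simpa using hD0, ?_⟩
  have h1 := congrArg (Polynomial.map φ) hE
  rw [Polynomial.map_mul, map_C, Polynomial.map_map, hφ] at h1
  rw [h1, ← gcd_map, Polynomial.map_map, Polynomial.map_map, hφ, hpQ, hpQ]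

theorem exists_comp_coprime {f h h₁ g g₁ : ℂ[X]} (hf : 1 ≤ f.natDegree) (hfg : f = g.comp h)
    (hfg₁ : f = g₁.comp h₁) :
    ∃ v A B : ℂ[X], h = A.comp v ∧ h₁ = B.comp v ∧ A.natDegree.Coprime B.natDegree := by
  classical
  obtain ⟨z, hz⟩ := exists_isBranches f hf
  have hN : f.natDegree = g.natDegree * h.natDegree := by rw [hfg, natDegree_comp]
  have hN₁ : f.natDegree = g₁.natDegree * h₁.natDegree := by rw [hfg₁, natDegree_comp]
  have hh : 1 ≤ h.natDegree := by
    by_contra! hlt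
    rw [Nat.lt_one_iff.mp hlt, mul_zero] at hN; omega
  have hh₁ : 1 ≤ h₁.natDegree := by
    by_contra! hlt
    rw [Nat.lt_one_iff.mp hlt, mul_zero] at hN₁; omega
  set k := h.natDegree.gcd h₁.natDegree with hk
  have hk1 : 1 ≤ k := Nat.gcd_pos_of_pos_left _ hh
  have hkd : k ∣ h.natDegree := Nat.gcd_dvd_left _ _
  have hkd₁ : k ∣ h₁.natDegree := Nat.gcd_dvd_right _ _
  have hkN : k ∣ f.natDegree := hkd.trans ⟨_, by rw [hN, mul_comm]⟩
  have hpow : ∀ {m n : ℕ} {ζ : ℂ}, m ∣ n → ζ ^ m = 1 → ζ ^ n = 1 := by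
    rintro m n ζ ⟨s, rfl⟩ h
    rw [pow_mul, h, one_pow]
  let Q : ℂ → ℂ[X] → SeriesField[X] := fun ζ h =>
    h.map (algebraMap ℂ SeriesField) - C (aeval (z ζ) h)
  obtain ⟨E, hEm, hgcd⟩ := exists_generic_gcd (L := SeriesField) hh h₁
  let M : ℂ → SeriesField[X] := fun ζ => E.map (aeval (R := ℂ) (z ζ)).toRingHom
  have hMm : ∀ ζ, (M ζ).Monic := fun ζ => hEm.map _
  have hM : ∀ ζ : ℂ, ζ ^ f.natDegree = 1 → ∃ c : SeriesField, c ≠ 0 ∧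
      M ζ * C c = EuclideanDomain.gcd (Q ζ h) (Q ζ h₁) :=
    fun ζ hζ => hgcd (z ζ) fun r => hz.transcendental hf hζ
  have h1N : (1 : ℂ) ^ f.natDegree = 1 := one_pow _
  have hQeq : ∀ ζ : ℂ, ζ ^ k = 1 → aeval (z ζ) h = aeval (z 1) h ∧
      aeval (z ζ) h₁ = aeval (z 1) h₁ := by
    intro ζ hζ
    constructor
    · simpa using hz.aeval_mul_eq hf hfg h1N (hpow hkd hζ)
    · simpa using hz.aeval_mul_eq hf hfg₁ h1N (hpow hkd₁ hζ)
  have hMeq : ∀ ζ : ℂ, ζ ^ k = 1 → M ζ = M 1 := by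
    intro ζ hζ
    obtain ⟨c, hc, h1⟩ := hM ζ (hpow hkN hζ)
    obtain ⟨c', hc', h2⟩ := hM 1 h1N
    have h3 : M ζ * C c = M 1 * C c' := by
      rw [h1, h2]
      simp only [Q, hQeq ζ hζ]
    have h4 := congrArg leadingCoeff h3
    rw [leadingCoeff_mul, leadingCoeff_mul, (hMm _).leadingCoeff, (hMm _).leadingCoeff, one_mul,
      one_mul, leadingCoeff_C, leadingCoeff_C] at h4
    rw [← h4] at h3
    exact mul_right_cancel₀ (C_ne_zero.mpr hc) h3
  set v := E.coeff 0
  have hv : ∀ ζ, aeval (z ζ) v = (M ζ).coeff 0 := fun ζ => by simp [M, v]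
  obtain ⟨hr, hs⟩ := hz.roots_eq hf hfg hh h1N
  obtain ⟨hr₁, -⟩ := hz.roots_eq hf hfg₁ hh₁ h1N
  obtain ⟨-, hQ0⟩ := map_sub_C_ne_zero hh (aeval (z 1) h)
  obtain ⟨-, hQ₁0⟩ := map_sub_C_ne_zero hh₁ (aeval (z 1) h₁)
  simp only [one_mul] at hr hr₁
  have hinj : Set.InjOn z (nthRootsFinset k (1 : ℂ)) := by
    simpa using hz.injOn_mul hf hkN hk1 h1N
  have hMdvd : M 1 ∣ Q 1 h := by
    obtain ⟨c, -, h1⟩ := hM 1 h1N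
    exact (Dvd.intro _ h1).trans (EuclideanDomain.gcd_dvd_left _ _)
  have hMle : (M 1).roots ≤ (Q 1 h).roots := roots.le_of_dvd hQ0 hMdvd
  have hnodup : (M 1).roots.Nodup := by
    refine Multiset.nodup_of_le hMle ?_
    rw [hr]
    have := hz.injOn_mul hf (k := h.natDegree) ⟨_, by rw [hN, mul_comm]⟩ hh h1N
    simp only [one_mul] at this
    exact (Multiset.nodup_map_iff_inj_on (Finset.nodup _)).mpr
      fun a ha b hb hab => this ha hb hab
  have hMroots : (M 1).roots = (nthRootsFinset k (1 : ℂ)).val.map z := by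
    refine (Multiset.Nodup.ext hnodup ((Multiset.nodup_map_iff_inj_on (Finset.nodup _)).mpr
      fun a ha b hb hab => hinj ha hb hab)).mpr fun y => ?_
    obtain ⟨c, hc, h1⟩ := hM 1 h1N
    have h2 : y ∈ (M 1).roots ↔ y ∈ (Q 1 h).roots ∧ y ∈ (Q 1 h₁).roots := by
      rw [mem_roots (hMm 1).ne_zero, mem_roots hQ0, mem_roots hQ₁0,
        ← isRoot_gcd_iff_isRoot_left_right]
      change _ ↔ IsRoot (EuclideanDomain.gcd (Q 1 h) (Q 1 h₁)) y
      rw [← h1]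
      simp [IsRoot, hc]
    rw [h2, hr, hr₁]
    simp only [Multiset.mem_map, Finset.mem_val, mem_nthRootsFinset_complex hh,
      mem_nthRootsFinset_complex hh₁, mem_nthRootsFinset_complex hk1]
    constructor
    · rintro ⟨⟨a, ha, rfl⟩, b, hb, hab⟩
      have : b = a := hz.injOn (hpow ⟨_, by rw [hN₁, mul_comm]⟩ hb)
        (hpow ⟨_, by rw [hN, mul_comm]⟩ ha) hab
      subst this
      exact ⟨b, pow_gcd_eq_one.mpr ⟨ha, hb⟩, rfl⟩
    · rintro ⟨a, ha, rfl⟩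
      exact ⟨⟨a, hpow hkd ha, rfl⟩, a, hpow hkd₁ ha, rfl⟩
  have hM1 : (M 1).coeff 0 = ∏ ζ ∈ nthRootsFinset k (1 : ℂ),
      algebraMap ℂ SeriesField (-1) * z ζ := by
    have h1 := (hs.of_dvd hQ0 hMdvd).eq_prod_roots_of_monic (hMm 1)
    rw [coeff_zero_eq_eval_zero, h1, hMroots, eval_multiset_prod, Multiset.map_map,
      Multiset.map_map, Finset.prod]
    congr 1
    refine Multiset.map_congr rfl fun a _ => ?_
    simp
  have hvdeg : v.natDegree = k := by
    have h1 := (hz.lead 1 h1N).aeval v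
    rw [hv, hM1, one_pow, mul_one] at h1
    have h2 := HasLead.prod (nthRootsFinset k (1 : ℂ)) (k := 0 + 1)
      (a := fun ζ => algebraMap ℂ SeriesField (-1) * z ζ) (c := fun ζ => -1 * ζ)
      fun ζ hζ => (HasLead.const (-1)).mul
        (hz.lead ζ (hpow hkN ((mem_nthRootsFinset_complex hk1).mp hζ)))
    rw [card_nthRootsFinset_complex hk1] at h2
    have h3 : ∏ ζ ∈ nthRootsFinset k (1 : ℂ), -1 * ζ ≠ 0 := by
      refine Finset.prod_ne_zero_iff.mpr fun ζ hζ => mul_ne_zero (by norm_num) ?_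
      rintro rfl
      have := (mem_nthRootsFinset_complex hk1).mp hζ
      rw [zero_pow (by omega)] at this
      exact zero_ne_one this
    have h4 : v.leadingCoeff ≠ 0 := by
      rw [leadingCoeff_ne_zero]
      intro h0
      rw [h0, natDegree_zero, leadingCoeff_zero] at h1
      exact h3 (h1.eq_zero_of_lt h2 (by omega))
    simpa using h1.order_unique h2 h4 h3
  have hcomp : ∀ q : ℂ[X], (∀ ζ : ℂ, ζ ^ k = 1 → aeval (z ζ) q = aeval (z 1) q) →
      ∃ w : ℂ[X], q = w.comp v := by
    intro q hq
    refine exists_eq_comp_of_fibre (fun r => hz.transcendental hf h1N) (hvdeg ▸ hk1) q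
      ((nthRootsFinset k (1 : ℂ)).image z) ?_ ?_ ?_
    · rw [Finset.card_image_of_injOn hinj, card_nthRootsFinset_complex hk1, hvdeg]
    · intro y hy
      obtain ⟨ζ, hζ, rfl⟩ := Finset.mem_image.mp hy
      rw [hv, hv, hMeq ζ ((mem_nthRootsFinset_complex hk1).mp hζ)]
    · intro y hy
      obtain ⟨ζ, hζ, rfl⟩ := Finset.mem_image.mp hy
      exact hq ζ ((mem_nthRootsFinset_complex hk1).mp hζ)
  obtain ⟨A, hA⟩ := hcomp h fun ζ hζ => (hQeq ζ hζ).1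
  obtain ⟨B, hB⟩ := hcomp h₁ fun ζ hζ => (hQeq ζ hζ).2
  refine ⟨v, A, B, hA, hB, ?_⟩
  have hdA : h.natDegree = A.natDegree * k := by rw [hA, natDegree_comp, hvdeg]
  have hdB : h₁.natDegree = B.natDegree * k := by rw [hB, natDegree_comp, hvdeg]
  have : k = A.natDegree.gcd B.natDegree * k := by rw [← Nat.gcd_mul_right, ← hdA, ← hdB]
  exact Nat.eq_of_mul_eq_mul_right hk1 (by rw [← this, one_mul])


/-- The norm of `q` along the fibres of `A` is a polynomial. -/
theorem exists_norm_polynomial {A : ℂ[X]} (hA : 1 ≤ A.natDegree) (q : ℂ[X]) {n : ℕ}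
    (hn : q.natDegree ≤ n) :
    ∃ R : ℂ[X], ∀ (L : Type) [Field L] [Algebra ℂ L] (y : L),
      (A.map (algebraMap ℂ L) - C y).Splits →
      aeval y R = algebraMap ℂ L (A.leadingCoeff ^ n) *
        ((A.map (algebraMap ℂ L) - C y).roots.map fun r => aeval r q).prod := by
  refine ⟨resultant (A.map C - C X) (q.map C) A.natDegree n, fun L _ _ y hs => ?_⟩
  have hcomp : (aeval (R := ℂ) y).toRingHom.comp C = algebraMap ℂ L := by ext; simp
  obtain ⟨hd, -⟩ := map_sub_C_ne_zero hA y
  have h1 := resultant_map_map (A.map C - C X) (q.map C) A.natDegree n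
    (aeval (R := ℂ) y).toRingHom
  rw [Polynomial.map_sub, map_C, Polynomial.map_map, Polynomial.map_map, hcomp] at h1
  have h2 : (aeval (R := ℂ) y).toRingHom X = y := aeval_X y
  rw [h2] at h1
  refine h1.symm.trans ?_
  conv_lhs => rw [← hd]
  rw [resultant_eq_prod_eval _ _ n (natDegree_map_le.trans hn) hs]
  congr 1
  · rw [leadingCoeff, hd, coeff_sub, coeff_C, if_neg (by omega), sub_zero, coeff_map,
      coeff_natDegree, map_pow]
  · simp only [eval_map_algebraMap]

theorem exists_mul_eq_of_coprime {a b : ℕ} (hab : a.Coprime b) {ζ : ℂ} (hζ0 : ζ ≠ 0)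
    (hζ : ζ ^ (a * b) = 1) : ∃ α β : ℂ, α ^ a = 1 ∧ β ^ b = 1 ∧ α * β = ζ := by
  refine ⟨ζ ^ ((b : ℤ) * a.gcdB b), ζ ^ ((a : ℤ) * a.gcdA b), ?_, ?_, ?_⟩
  · rw [← zpow_natCast, ← zpow_mul, show (b : ℤ) * a.gcdB b * a = ((a * b : ℕ) : ℤ) * a.gcdB b by
      push_cast; ring, zpow_mul, zpow_natCast, hζ, one_zpow]
  · rw [← zpow_natCast, ← zpow_mul, show (a : ℤ) * a.gcdA b * b = ((a * b : ℕ) : ℤ) * a.gcdA b by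
      push_cast; ring, zpow_mul, zpow_natCast, hζ, one_zpow]
  · have := Nat.gcd_eq_gcd_ab a b
    rw [hab.gcd_eq_one] at this
    rw [← zpow_add₀ hζ0, add_comm, ← this]
    simp

theorem exists_common_comp {f A B g g₁ : ℂ[X]} (hf : 1 ≤ f.natDegree) (hfg : f = g.comp A)
    (hfg₁ : f = g₁.comp B) (hAB : A.natDegree.Coprime B.natDegree) :
    ∃ (G P Q : ℂ[X]) (q : ℂ), q ≠ 0 ∧ g = G.comp P ∧ P.natDegree = B.natDegree ∧
      P.comp A = Q.comp B ∧
      ∀ y : ℂ, Q - C (P.eval y) =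
        C q * ((A - C y).roots.map fun r => X - C (B.eval r)).prod := by
  classical
  obtain ⟨z, hz⟩ := exists_isBranches f hf
  have hN : f.natDegree = g.natDegree * A.natDegree := by rw [hfg, natDegree_comp]
  have hN₁ : f.natDegree = g₁.natDegree * B.natDegree := by rw [hfg₁, natDegree_comp]
  have hA : 1 ≤ A.natDegree := by
    by_contra! hlt
    rw [Nat.lt_one_iff.mp hlt, mul_zero] at hN; omega
  have hB : 1 ≤ B.natDegree := by
    by_contra! hlt
    rw [Nat.lt_one_iff.mp hlt, mul_zero] at hN₁; omega
  set a := A.natDegree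
  set b := B.natDegree
  have haN : a ∣ f.natDegree := ⟨_, by rw [hN, mul_comm]⟩
  have hbN : b ∣ f.natDegree := ⟨_, by rw [hN₁, mul_comm]⟩
  have habN : a * b ∣ f.natDegree := hAB.mul_dvd_of_dvd_of_dvd haN hbN
  have hab1 : 1 ≤ a * b := Nat.mul_pos hA hB
  have hpow : ∀ {m n : ℕ} {ζ : ℂ}, m ∣ n → ζ ^ m = 1 → ζ ^ n = 1 := by
    rintro m n ζ ⟨s, rfl⟩ h
    rw [pow_mul, h, one_pow]
  have h1N : (1 : ℂ) ^ f.natDegree = 1 := one_pow _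
  have hlcA : A.leadingCoeff ≠ 0 := leadingCoeff_ne_zero.mpr (by rintro rfl; simp [a] at hA)
  set l := A.leadingCoeff ^ b
  have hl : l ≠ 0 := pow_ne_zero _ hlcA
  have hlL : algebraMap ℂ SeriesField l ≠ 0 := by simpa using hl
  have hinj : ∀ {k : ℕ}, 1 ≤ k → k ∣ f.natDegree → Set.InjOn z (nthRootsFinset k (1 : ℂ)) := by
    intro k hk hkN
    simpa using hz.injOn_mul hf hkN hk h1N
  -- the norm of a polynomial along the fibre of `A` through a branch
  have hnorm : ∀ {R q : ℂ[X]}, (∀ (L : Type) [Field L] [Algebra ℂ L] (y : L),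
      (A.map (algebraMap ℂ L) - C y).Splits → aeval y R = algebraMap ℂ L l *
        ((A.map (algebraMap ℂ L) - C y).roots.map fun r => aeval r q).prod) →
      ∀ η : ℂ, η ^ f.natDegree = 1 → aeval (aeval (z η) A) R = algebraMap ℂ SeriesField l *
        ∏ ζ ∈ nthRootsFinset a (1 : ℂ), aeval (z (η * ζ)) q := by
    intro R q hR η hη
    obtain ⟨hr, hs⟩ := hz.roots_eq hf hfg hA hη
    rw [hR _ _ hs, hr, Multiset.map_map]
    rfl
  obtain ⟨P, hP⟩ := exists_norm_polynomial hA B (n := b) le_rfl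
  have hPz := hnorm hP
  have hPdeg : P.natDegree = b := by
    have h1 := (hz.lead 1 h1N).aeval (P.comp A)
    rw [aeval_comp, hPz 1 h1N, one_pow, mul_one] at h1
    have h2 := (HasLead.const l).mul (HasLead.prod (nthRootsFinset a (1 : ℂ))
      fun ζ hζ => (hz.lead (1 * ζ) (by
        rw [one_mul]
        exact hpow haN ((mem_nthRootsFinset_complex hA).mp hζ))).aeval B)
    rw [card_nthRootsFinset_complex hA] at h2
    have h3 : l * ∏ ζ ∈ nthRootsFinset a (1 : ℂ),
        B.leadingCoeff * (1 * ζ) ^ B.natDegree ≠ 0 := by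
      refine mul_ne_zero hl (Finset.prod_ne_zero_iff.mpr fun ζ hζ => mul_ne_zero ?_ ?_)
      · exact leadingCoeff_ne_zero.mpr (by rintro rfl; simp [b] at hB)
      · refine pow_ne_zero _ ?_
        rw [one_mul]
        rintro rfl
        have := (mem_nthRootsFinset_complex hA).mp hζ
        rw [zero_pow (by omega)] at this
        exact zero_ne_one this
    have h4 : (P.comp A).leadingCoeff ≠ 0 := by
      rw [leadingCoeff_ne_zero]
      intro h0
      rw [h0, natDegree_zero, leadingCoeff_zero] at h1
      exact h3 (h1.eq_zero_of_lt h2 (by rw [zero_add]; exact hab1))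
    have h5 := h1.order_unique h2 h4 h3
    rw [natDegree_comp, zero_add, mul_comm] at h5
    exact Nat.eq_of_mul_eq_mul_left hA h5
  have hudeg : (P.comp A).natDegree = a * b := by rw [natDegree_comp, hPdeg, mul_comm]
  have hBz : ∀ {η ζ : ℂ}, η ^ f.natDegree = 1 → ζ ^ b = 1 →
      aeval (z (η * ζ)) B = aeval (z η) B := fun hη hζ => hz.aeval_mul_eq hf hfg₁ hη hζ
  have hub : ∀ {ζ : ℂ}, ζ ^ b = 1 → aeval (z ζ) (P.comp A) = aeval (z 1) (P.comp A) := by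
    intro ζ hζ
    rw [aeval_comp, aeval_comp, hPz ζ (hpow hbN hζ), hPz 1 h1N]
    congr 1
    refine Finset.prod_congr rfl fun η hη => ?_
    rw [mul_comm ζ, hBz (hpow haN ((mem_nthRootsFinset_complex hA).mp hη)) hζ, one_mul]
  have htr : ∀ r : ℂ[X], aeval (z 1) r = 0 → r = 0 := fun r => hz.transcendental hf h1N
  obtain ⟨Q, hQ⟩ := exists_eq_comp_of_fibre htr hB (P.comp A) ((nthRootsFinset b (1 : ℂ)).image z)
    (by rw [Finset.card_image_of_injOn (hinj hB hbN), card_nthRootsFinset_complex hB])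
    (by
      intro y hy
      obtain ⟨ζ, hζ, rfl⟩ := Finset.mem_image.mp hy
      simpa using hBz h1N ((mem_nthRootsFinset_complex hB).mp hζ))
    (by
      intro y hy
      obtain ⟨ζ, hζ, rfl⟩ := Finset.mem_image.mp hy
      exact hub ((mem_nthRootsFinset_complex hB).mp hζ))
  have hQdeg : Q.natDegree = a := by
    have h1 := hudeg
    rw [hQ, natDegree_comp] at h1
    exact Nat.eq_of_mul_eq_mul_right hB h1
  have huab : ∀ {ζ : ℂ}, ζ ^ (a * b) = 1 → aeval (z ζ) (P.comp A) = aeval (z 1) (P.comp A) := by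
    intro ζ hζ
    have hζ0 : ζ ≠ 0 := by
      rintro rfl
      rw [zero_pow (by omega)] at hζ
      exact zero_ne_one hζ
    obtain ⟨α, β, hα, hβ, rfl⟩ := exists_mul_eq_of_coprime hAB hζ0 hζ
    rw [hQ, aeval_comp, hBz (hpow haN hα) hβ, ← aeval_comp, ← hQ, aeval_comp, aeval_comp]
    have := hz.aeval_mul_eq hf hfg h1N hα
    rw [one_mul] at this
    rw [this]
  obtain ⟨G, hG⟩ := exists_eq_comp_of_fibre htr (hudeg ▸ hab1) f
    ((nthRootsFinset (a * b) (1 : ℂ)).image z)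
    (by rw [Finset.card_image_of_injOn (hinj hab1 habN), card_nthRootsFinset_complex hab1, hudeg])
    (by
      intro y hy
      obtain ⟨ζ, hζ, rfl⟩ := Finset.mem_image.mp hy
      exact huab ((mem_nthRootsFinset_complex hab1).mp hζ))
    (by
      intro y hy
      obtain ⟨ζ, hζ, rfl⟩ := Finset.mem_image.mp hy
      exact hz.aeval_eq ζ (hpow habN ((mem_nthRootsFinset_complex hab1).mp hζ)))
  have hQ0 : Q.leadingCoeff ≠ 0 := leadingCoeff_ne_zero.mpr (by
    rintro rfl
    rw [natDegree_zero] at hQdeg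
    omega)
  have hcancel : ∀ {p q : ℂ[X]}, p.comp A = q.comp A → p = q := by
    intro p q hpq
    rw [← sub_eq_zero, ← sub_comp, comp_eq_zero_iff] at hpq
    rcases hpq with h | ⟨-, h⟩
    · exact sub_eq_zero.mp h
    · have : A.natDegree = 0 := by rw [h, natDegree_C]
      omega
  refine ⟨G, P, Q, Q.leadingCoeff, hQ0, ?_, hPdeg, hQ, ?_⟩
  · apply hcancel
    rw [← hfg, comp_assoc, ← hG]
  -- the generic fibre
  have hfac : Q.map (algebraMap ℂ SeriesField) - C (aeval (aeval (z 1) A) P) =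
      C (algebraMap ℂ SeriesField Q.leadingCoeff) *
        ∏ ζ ∈ nthRootsFinset a (1 : ℂ), (X - C (aeval (z ζ) B)) := by
    have hinjB : Set.InjOn (fun ζ => aeval (z ζ) B) (nthRootsFinset a (1 : ℂ)) := by
      intro ζ hζ η hη h
      have hζ' := (mem_nthRootsFinset_complex hA).mp hζ
      have hη' := (mem_nthRootsFinset_complex hA).mp hη
      have hη0 : η ≠ 0 := by
        rintro rfl
        rw [zero_pow (by omega)] at hη'
        exact zero_ne_one hη'
      have h1 := hz.pow_eq_of_aeval_eq (by rintro rfl; simp [b] at hB) (hpow haN hζ')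
        (hpow haN hη') h
      have h2 : (ζ / η) ^ a = 1 := by rw [div_pow, hζ', hη', div_one]
      have h3 : (ζ / η) ^ b = 1 := by rw [div_pow, h1, div_self (pow_ne_zero _ hη0)]
      have h4 := pow_gcd_eq_one.mpr ⟨h2, h3⟩
      rw [hAB.gcd_eq_one, pow_one] at h4
      exact (div_eq_one_iff_eq hη0).mp h4
    obtain ⟨hd, h0⟩ := map_sub_C_ne_zero (p := Q) (by omega) (aeval (aeval (z 1) A) P)
    obtain ⟨hr, hs⟩ := roots_eq_val_of_card h0
      ((nthRootsFinset a (1 : ℂ)).image fun ζ => aeval (z ζ) B)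
      (by
        intro y hy
        obtain ⟨ζ, hζ, rfl⟩ := Finset.mem_image.mp hy
        have h1 := huab (hpow (Dvd.intro _ rfl) ((mem_nthRootsFinset_complex hA).mp hζ))
        rw [← aeval_comp, ← h1, hQ]
        simp [aeval_comp])
      (by rw [hd, hQdeg, Finset.card_image_of_injOn hinjB, card_nthRootsFinset_complex hA])
    rw [hs.eq_prod_roots, hr, Finset.image_val_of_injOn hinjB, Multiset.map_map]
    congr 2
    rw [leadingCoeff, hd, coeff_sub, coeff_C, if_neg (by omega), sub_zero, coeff_map,
      coeff_natDegree]
  intro y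
  refine Polynomial.funext fun τ => ?_
  obtain ⟨R, hR⟩ := exists_norm_polynomial hA (C τ - B) (n := b)
    ((natDegree_sub_le _ _).trans (by simp [b]))
  have hRP : C Q.leadingCoeff * R = C l * (C (Q.eval τ) - P) := by
    apply hcancel
    rw [← sub_eq_zero]
    apply htr
    have h1 := congrArg (eval (algebraMap ℂ SeriesField τ)) hfac
    simp only [eval_sub, eval_mul, eval_C, eval_prod, eval_X, eval_map_algebraMap,
      aeval_algebraMap_apply] at h1
    have h2 := hnorm hR 1 h1N
    simp only [one_mul, map_sub, aeval_C] at h2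
    simp only [mul_comp, C_comp, sub_comp, map_sub, map_mul, aeval_C, aeval_comp]
    rw [h2, coe_aeval_eq_eval] at *
    linear_combination (-algebraMap ℂ SeriesField l) * h1
  have h1 := congrArg (eval y) hRP
  have h2 := hR ℂ y (IsAlgClosed.splits _)
  simp only [Algebra.algebraMap_self, Polynomial.map_id, RingHom.id_apply, coe_aeval_eq_eval,
    eval_sub, eval_C] at h2
  simp only [eval_mul, eval_C, eval_sub] at h1
  rw [h2] at h1
  rw [eval_mul, eval_multiset_prod, Multiset.map_map]
  simp only [Function.comp_def, eval_sub, eval_X, eval_C]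
  apply mul_left_cancel₀ hl
  linear_combination -h1


theorem exists_eval_eq {p : ℂ[X]} (hp : 1 ≤ p.natDegree) (c : ℂ) : ∃ a : ℂ, p.eval a = c := by
  obtain ⟨a, ha⟩ := IsAlgClosed.exists_root (p - C c) (by
    rw [degree_sub_C (natDegree_pos_iff_degree_pos.mp hp)]
    exact (natDegree_pos_iff_degree_pos.mp hp).ne')
  exact ⟨a, by simpa [sub_eq_zero] using ha⟩

theorem exists_derivative_eval_eq_zero {p : ℂ[X]} (hp : 2 ≤ p.natDegree) :
    ∃ a : ℂ, (derivative p).eval a = 0 :=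
  exists_eval_eq (by rw [natDegree_derivative]; omega) 0

/-- A fibre of `p` consisting of a single point is ramified. -/
theorem derivative_eval_eq_zero_of_fibre {p : ℂ[X]} (hp : 2 ≤ p.natDegree) {y : ℂ}
    (h : ∀ y', p.eval y' = p.eval y → y' = y) : (derivative p).eval y = 0 := by
  obtain ⟨q, hq⟩ := dvd_iff_isRoot.mpr (show IsRoot (p - C (p.eval y)) y by simp)
  have hd : (p - C (p.eval y)).natDegree = p.natDegree := natDegree_sub_C
  have hq0 : q ≠ 0 := by
    rintro rfl
    rw [hq, mul_zero, natDegree_zero] at hd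
    omega
  rw [hq, natDegree_mul (X_sub_C_ne_zero _) hq0, natDegree_X_sub_C] at hd
  obtain ⟨y', hy'⟩ := exists_eval_eq (p := q) (by omega) 0
  have h1 := congrArg (eval y') hq
  rw [eval_mul, hy', mul_zero, eval_sub, eval_C, sub_eq_zero] at h1
  rw [h y' h1] at hy'
  have h2 := congrArg (fun r => (derivative r).eval y) hq
  simpa [hy'] using h2

theorem comp_of_coprime_not_ramified {G P Q A B v : ℂ[X]} {q : ℂ}
    (hmerge : CriticalValuesDoNotMerge (G.comp P) (A.comp v)) (hv : 1 ≤ v.natDegree)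
    (hA : 2 ≤ A.natDegree) (hq : q ≠ 0) (hPQ : P.comp A = Q.comp B)
    (hfib : ∀ y : ℂ, Q - C (P.eval y) =
        C q * ((A - C y).roots.map fun r => X - C (B.eval r)).prod) :
    P.natDegree < 2 := by
  by_contra! hP
  obtain ⟨hm1, hm2⟩ := hmerge
  obtain ⟨b, hb⟩ := exists_derivative_eval_eq_zero hA
  obtain ⟨β, hβ⟩ := exists_eval_eq hv b
  have hP' : ∀ y, P.eval y = P.eval (A.eval b) → (derivative P).eval y ≠ 0 := by
    intro y hy h0
    obtain ⟨x, hx⟩ := exists_eval_eq (show 1 ≤ A.natDegree by omega) y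
    obtain ⟨t, ht⟩ := exists_eval_eq hv x
    refine hm1 ⟨t, β, ?_, ?_, ?_⟩
    · simp [derivative_comp, ht, hx, h0]
    · simp [derivative_comp, hβ, hb]
    · simp [ht, hx, hβ, hy]
  obtain ⟨y, hy, hne⟩ : ∃ y, P.eval y = P.eval (A.eval b) ∧ y ≠ A.eval b := by
    by_contra! h
    exact hP' _ rfl (derivative_eval_eq_zero_of_fibre hP h)
  have hA0 : ∀ c, A - C c ≠ 0 := by
    intro c h0
    have : (A - C c).natDegree = A.natDegree := natDegree_sub_C
    rw [h0, natDegree_zero] at this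
    omega
  -- `B b` is a double root of `Q - Q (B b)`
  have hQ' : (derivative Q).eval (B.eval b) = 0 := by
    have h2 : 1 < (A - C (A.eval b)).rootMultiplicity b :=
      (one_lt_rootMultiplicity_iff_isRoot (hA0 _)).mpr ⟨by simp, by simpa using hb⟩
    rw [← count_roots] at h2
    have h3 : Multiset.replicate 2 b ≤ (A - C (A.eval b)).roots :=
      Multiset.le_count_iff_replicate_le.mp h2
    obtain ⟨s, hs⟩ := Multiset.le_iff_exists_add.mp h3
    have h4 := congrArg (fun r => (derivative r).eval (B.eval b)) (hfib (A.eval b))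
    rw [hs] at h4
    simpa using h4
  -- the fibre of `B` through this root meets the fibre of `A` over `y`
  obtain ⟨r, hr, hBr⟩ : ∃ r, A.eval r = y ∧ B.eval r = B.eval b := by
    have h1 := congrArg (eval (B.eval b)) (hfib y)
    have h2 : Q.eval (B.eval b) = P.eval y := by
      rw [hy, ← eval_comp, ← eval_comp, hPQ]
    rw [eval_sub, eval_C, h2, sub_self, eval_mul, eval_C, eval_multiset_prod, zero_eq_mul] at h1
    have h3 := h1.resolve_left hq
    rw [Multiset.prod_eq_zero_iff, Multiset.map_map, Multiset.mem_map] at h3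
    obtain ⟨r, hr, h4⟩ := h3
    rw [mem_roots (hA0 _)] at hr
    refine ⟨r, by simpa [sub_eq_zero] using hr, ?_⟩
    refine (sub_eq_zero.mp ?_).symm
    simpa using h4
  have hAr : (derivative A).eval r = 0 := by
    have h1 := congrArg (fun p => (derivative p).eval r) hPQ
    simp only [derivative_comp, eval_mul, eval_comp, hBr, hQ', mul_zero, hr] at h1
    exact (mul_eq_zero.mp h1).resolve_right (hP' y hy)
  obtain ⟨ρ, hρ⟩ := exists_eval_eq hv r
  refine hne ?_
  have := hm2 ρ β (by simp [derivative_comp, hρ, hAr]) (by simp [derivative_comp, hβ, hb])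
    (by simp [hρ, hr, hβ, hy])
  simpa [hρ, hr, hβ] using this

theorem exists_comp_of_natDegree_eq_one {A : ℂ[X]} (hA : A.natDegree = 1) (B v : ℂ[X]) :
    ∃ w : ℂ[X], B.comp v = w.comp (A.comp v) := by
  obtain ⟨a, b, ha, rfl⟩ : ∃ a b : ℂ, a ≠ 0 ∧ A = C a * X + C b := by
    refine ⟨A.coeff 1, A.coeff 0, ?_, eq_X_add_C_of_natDegree_le_one hA.le⟩
    rw [← hA]
    exact leadingCoeff_ne_zero.mpr (by rintro rfl; simp at hA)
  refine ⟨B.comp (C a⁻¹ * (X - C b)), ?_⟩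
  rw [comp_assoc]
  congr 1
  simp only [mul_comp, sub_comp, add_comp, C_comp, X_comp, add_sub_cancel_right]
  rw [← mul_assoc, ← C_mul, inv_mul_cancel₀ ha, C_1, one_mul]

/-- If `f = f̃ ∘ h` with `deg f̃, deg h ≥ 2` and the critical values of `f̃`
and `h` do not merge, then for any factorization `f = f₁ ∘ h₁` into nonconstant polynomials
there is `w` with `h₁ = w ∘ h` or `h = w ∘ h₁`. -/
theorem stmt_10 (ftilde h f : Polynomial ℂ)
    (hft : 2 ≤ ftilde.natDegree) (hh : 2 ≤ h.natDegree)
    (hcomp : f = ftilde.comp h)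
    (hmerge : CriticalValuesDoNotMerge ftilde h)
    (f₁ h₁ : Polynomial ℂ) (hf₁ : 1 ≤ f₁.natDegree) (hh₁ : 1 ≤ h₁.natDegree)
    (hcomp₁ : f = f₁.comp h₁) :
    ∃ w : Polynomial ℂ, h₁ = w.comp h ∨ h = w.comp h₁ := by
  have hf : 1 ≤ f.natDegree := by
    rw [hcomp₁, natDegree_comp]
    exact Nat.mul_pos hf₁ hh₁
  obtain ⟨v, A, B, rfl, rfl, hAB⟩ := exists_comp_coprime hf hcomp hcomp₁
  rw [natDegree_comp] at hh hh₁
  have hv : 1 ≤ v.natDegree := Nat.pos_of_mul_pos_left hh₁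
  have hA : 1 ≤ A.natDegree := Nat.pos_of_mul_pos_right (by omega : 0 < A.natDegree * v.natDegree)
  have hB : 1 ≤ B.natDegree := Nat.pos_of_mul_pos_right hh₁
  by_cases hA1 : A.natDegree = 1
  · obtain ⟨w, hw⟩ := exists_comp_of_natDegree_eq_one hA1 B v
    exact ⟨w, Or.inl hw⟩
  have heq : ftilde.comp A = f₁.comp B := by
    rw [hcomp, ← comp_assoc, ← comp_assoc, ← sub_eq_zero, ← sub_comp, comp_eq_zero_iff] at hcomp₁
    rcases hcomp₁ with h | ⟨-, h⟩
    · exact sub_eq_zero.mp h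
    · rw [h, natDegree_C] at hv
      omega
  obtain ⟨G, P, Q, q, hq, rfl, hPd, hPQ, hfib⟩ := exists_common_comp
    (by rw [natDegree_comp]; exact Nat.mul_pos (by omega) hA) rfl heq hAB
  have hlt := comp_of_coprime_not_ramified hmerge hv (by omega) hq hPQ hfib
  obtain ⟨w, hw⟩ := exists_comp_of_natDegree_eq_one (A := B) (by omega) A v
  exact ⟨w, Or.inr hw⟩
end

section
/- Let m = d·r with d ≥ 2 and r ≥ 1, let I = {0,1,…,m−1}, and let the blocks be the residue classes B_i = {k ∈ I : k ≡ i (mod r)} for 0 ≤ i ≤ r−1 (each of size d). Let G be a subgroup of the symmetric group on I, let ε ∈ ℂ be a primitive m-th root of unity, and let n : I → ℂ satisfy ∑_{k ∈ I} n_{σ(k)} ε^k = 0 for every σ ∈ G. Fix i₀ and suppose that for every k₀ ∈ B_{i₀}, the stabilizer H of k₀ in G maps every block to itself, acts transitively on B_{i₀} ∖ {k₀}, and acts transitively on B_i for every i ≠ i₀. Then n is constant on B_{i₀}, with value (∑_{k ∈ B_{i₀}} n_k)/d. -/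
theorem sum_fin_mul_mod {M : Type*} [AddCommMonoid M] (d r : ℕ) (F : ℕ → ℕ → M) :
    ∑ k : Fin (d * r), F ((k : ℕ) % r) k =
      ∑ j : Fin r, ∑ i ∈ Finset.range d, F j (j + r * i) := by
  rw [← finProdFinEquiv.sum_comp, Fintype.sum_prod_type_right]
  refine Finset.sum_congr rfl fun j _ => ?_
  rw [Finset.sum_range]
  refine Finset.sum_congr rfl fun i _ => ?_
  simp [Nat.mod_eq_of_lt j.isLt]

/-- A weighting of the powers of a primitive root of unity which depends only on the residue
class of the exponent sums to zero. -/
theorem IsPrimitiveRoot.sum_mod_mul_pow_eq_zero {R : Type*} [CommRing R] [IsDomain R]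
    {d r : ℕ} (hd : 2 ≤ d) (hr : 1 ≤ r) {ε : R} (hε : IsPrimitiveRoot ε (d * r)) (g : ℕ → R) :
    ∑ k : Fin (d * r), g ((k : ℕ) % r) * ε ^ (k : ℕ) = 0 := by
  rw [sum_fin_mul_mod d r fun j k => g j * ε ^ k]
  have hpow : IsPrimitiveRoot (ε ^ r) d := hε.pow (by positivity) (mul_comm d r)
  refine Finset.sum_eq_zero fun j _ => ?_
  have hgeom := hpow.geom_sum_eq_zero (by lia)
  simp_rw [pow_add, pow_mul, ← mul_assoc]
  rw [← Finset.mul_sum, hgeom, mul_zero]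

theorem card_filter_fin_mod_eq (d r i : ℕ) (hi : i < r) :
    (Finset.univ.filter fun k : Fin (d * r) => (k : ℕ) % r = i).card = d := by
  rw [Finset.card_filter, sum_fin_mul_mod d r fun j _ => if j = i then 1 else 0]
  rw [Finset.sum_eq_single ⟨i, hi⟩]
  · simp
  · intro j _ hj
    simp [Fin.ext_iff] at hj
    simp [hj]
  · simp

/-- Summing a function along the elements of a subgroup of permutations gives an invariant
function. -/
theorem sum_subgroup_perm_apply {α M : Type*} [AddCommMonoid M] (H : Subgroup (Equiv.Perm α))
    [Fintype H] (n : α → M) (τ : H) (k : α) :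
    ∑ σ : H, n (σ.1 (τ.1 k)) = ∑ σ : H, n (σ.1 k) :=
  Equiv.sum_comp (Equiv.mulRight τ) fun σ : H => n (σ.1 k)

/-- Let `m = d * r` (`d ≥ 2`, `r ≥ 1`), blocks of `Fin m` the residue classes
mod `r`, `G ≤ Sym(Fin m)`, `ε` a primitive `m`-th root of unity, and `n` balanced w.r.t. `G`.
Fix `i₀ < r` and suppose for every `k₀` in the block `B_{i₀}` the stabilizer of `k₀` in `G`
maps every block to itself, acts transitively on `B_{i₀} \ {k₀}` and transitively on every
other block.  Then `n` is constant on `B_{i₀}`, with value `(∑_{k ∈ B_{i₀}} n k) / d`. -/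
theorem stmt_13 (m d r : ℕ) (hd : 2 ≤ d) (hr : 1 ≤ r) (hm : m = d * r)
    (G : Subgroup (Equiv.Perm (Fin m)))
    (ε : ℂ) (hε : IsPrimitiveRoot ε m) (n : Fin m → ℂ)
    (hbal : ∀ σ ∈ G, ∑ k : Fin m, n (σ k) * ε ^ (k : ℕ) = 0)
    (i₀ : ℕ) (hi₀ : i₀ < r)
    (hblocks : ∀ k₀ : Fin m, (k₀ : ℕ) % r = i₀ →
      ∀ σ ∈ G, σ k₀ = k₀ → ∀ k : Fin m, ((σ k : Fin m) : ℕ) % r = (k : ℕ) % r)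
    (htrans₀ : ∀ k₀ : Fin m, (k₀ : ℕ) % r = i₀ →
      ∀ a b : Fin m, (a : ℕ) % r = i₀ → (b : ℕ) % r = i₀ → a ≠ k₀ → b ≠ k₀ →
        ∃ σ ∈ G, σ k₀ = k₀ ∧ σ a = b)
    (htrans : ∀ k₀ : Fin m, (k₀ : ℕ) % r = i₀ →
      ∀ i < r, i ≠ i₀ → ∀ a b : Fin m, (a : ℕ) % r = i → (b : ℕ) % r = i →
        ∃ σ ∈ G, σ k₀ = k₀ ∧ σ a = b) :
    ∀ k : Fin m, (k : ℕ) % r = i₀ →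
      n k = (∑ j ∈ Finset.univ.filter (fun j : Fin m => (j : ℕ) % r = i₀), n j) / d := by
  classical
  subst hm
  intro k₀ hk₀
  let H : Subgroup (Equiv.Perm (Fin (d * r))) := G ⊓ MulAction.stabilizer _ k₀
  have hH : ∀ σ : H, σ.1 ∈ G ∧ σ.1 k₀ = k₀ := fun σ => σ.2
  let A : Fin (d * r) → ℂ := fun k => ∑ σ : H, n (σ.1 k)
  have hA : ∀ σ ∈ G, σ k₀ = k₀ → ∀ k, A (σ k) = A k := fun σ hσ hσk k =>
    sum_subgroup_perm_apply H n ⟨σ, hσ, hσk⟩ k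
  have hrep : ∀ i, ∃ a : Fin (d * r), i < r → (a : ℕ) % r = i ∧ a ≠ k₀ := by
    intro i
    by_cases hi : i < r
    · have hdr : 2 * r ≤ d * r := Nat.mul_le_mul_right r hd
      by_cases h : (k₀ : ℕ) = i
      · refine ⟨⟨i + r, by lia⟩, fun _ => ⟨by simp [Nat.mod_eq_of_lt hi], ?_⟩⟩
        simp only [ne_eq, Fin.ext_iff]
        lia
      · refine ⟨⟨i, by lia⟩, fun _ => ⟨by simp [Nat.mod_eq_of_lt hi], ?_⟩⟩
        simp only [ne_eq, Fin.ext_iff]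
        lia
    · exact ⟨k₀, fun h => absurd h hi⟩
  choose a ha using hrep
  have hAa : ∀ k, k ≠ k₀ → A k = A (a ((k : ℕ) % r)) := by
    intro k hk
    have hkr : (k : ℕ) % r < r := Nat.mod_lt _ hr
    obtain ⟨ha₁, ha₂⟩ := ha _ hkr
    by_cases hi : (k : ℕ) % r = i₀
    · obtain ⟨σ, hσ, hσk, hσa⟩ := htrans₀ k₀ hk₀ _ k (ha₁.trans hi) hi ha₂ hk
      rw [← hA σ hσ hσk (a _), hσa]
    · obtain ⟨σ, hσ, hσk, hσa⟩ := htrans k₀ hk₀ _ hkr hi _ k ha₁ rfl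
      rw [← hA σ hσ hσk (a _), hσa]
  have hsum : ∑ k, A k * ε ^ (k : ℕ) = 0 := by
    simp_rw [A, Finset.sum_mul]
    rw [Finset.sum_comm]
    exact Finset.sum_eq_zero fun σ _ => hbal σ.1 (hH σ).1
  have hAk₀ : A k₀ = A (a i₀) := by
    have hdiff : ∑ k, (A k - A (a ((k : ℕ) % r))) * ε ^ (k : ℕ) = 0 := by
      simp_rw [sub_mul]
      rw [Finset.sum_sub_distrib, hsum, hε.sum_mod_mul_pow_eq_zero hd hr fun j => A (a j), sub_zero]
    rw [Finset.sum_eq_single k₀ (fun k _ hk => by rw [hAa k hk, sub_self, zero_mul])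
      (by simp), hk₀] at hdiff
    have hε₀ : ε ≠ 0 := hε.ne_zero (by positivity)
    exact sub_eq_zero.mp ((mul_eq_zero.mp hdiff).resolve_right (pow_ne_zero _ hε₀))
  set B := Finset.univ.filter fun j : Fin (d * r) => (j : ℕ) % r = i₀ with hB
  have hconst : ∑ k ∈ B, A k = d * A k₀ := by
    rw [Finset.sum_congr rfl (g := fun _ => A k₀), Finset.sum_const, nsmul_eq_mul, hB,
      card_filter_fin_mod_eq d r i₀ hi₀]
    intro k hk
    by_cases h : k = k₀
    · rw [h]
    · rw [hAa k h, (Finset.mem_filter.mp hk).2, hAk₀]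
  have hswap : ∑ k ∈ B, A k = Fintype.card H * ∑ k ∈ B, n k := by
    rw [Finset.sum_comm, Finset.sum_congr rfl (g := fun _ => ∑ k ∈ B, n k), Finset.sum_const,
      nsmul_eq_mul, Finset.card_univ]
    intro σ _
    refine Finset.sum_equiv σ.1 (fun k => ?_) fun _ _ => rfl
    simp [hB, hblocks k₀ hk₀ σ.1 (hH σ).1 (hH σ).2 k]
  have hfix : A k₀ = Fintype.card H * n k₀ := by
    simp only [A, (hH _).2, Finset.sum_const, nsmul_eq_mul, Finset.card_univ]
  have hcard : (Fintype.card H : ℂ) ≠ 0 := Nat.cast_ne_zero.mpr Fintype.card_ne_zero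
  have hd₀ : (d : ℂ) ≠ 0 := Nat.cast_ne_zero.mpr (by lia)
  rw [eq_div_iff hd₀]
  apply mul_left_cancel₀ hcard
  rw [← hswap, hconst, hfix]
  ring
end

section
/- Let m = d·r with d ≥ 2 and r ≥ 1, let I = {0,1,…,m−1}, and let the blocks be the residue classes B_i = {k ∈ I : k ≡ i (mod r)} for 0 ≤ i ≤ r−1. Let G be a subgroup of the symmetric group on I, let ε ∈ ℂ be a primitive m-th root of unity, and let n : I → ℂ satisfy ∑_{k ∈ I} n_{σ(k)} ε^k = 0 for every σ ∈ G. Fix i₀ and let H = {σ ∈ G : σ(k) = k for every k ∈ B_{i₀}}; suppose H maps every block to itself and acts transitively on B_i for every i ≠ i₀. Then ∑_{k ∈ B_{i₀}} n_k ε^k = 0, i.e., the restriction of n to the block B_{i₀} is balanced. -/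
/-- A function on `Fin m` that is invariant under a shift by `r` sums to zero against the powers
of `ε`, provided `ε ^ m = 1` and `ε ^ r ≠ 1`. -/
theorem sum_mul_pow_eq_zero_of_add_eq {R : Type*} [CommRing R] [IsDomain R] {m r : ℕ} [NeZero m]
    {ε : R} (hm : ε ^ m = 1) (hr : ε ^ r ≠ 1) {f : Fin m → R}
    (hf : ∀ k, f (k + Fin.ofNat m r) = f k) :
    ∑ k : Fin m, f k * ε ^ (k : ℕ) = 0 := by
  have hpow (k : Fin m) : ε ^ ((k + Fin.ofNat m r : Fin m) : ℕ) = ε ^ r * ε ^ (k : ℕ) := by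
    rw [Fin.val_add, Fin.val_ofNat, Nat.add_mod_mod, ← pow_eq_pow_mod _ hm, pow_add, mul_comm]
  have hshift : ∑ k : Fin m, f k * ε ^ (k : ℕ) = ε ^ r * ∑ k : Fin m, f k * ε ^ (k : ℕ) := by
    conv_lhs => rw [← Equiv.sum_comp (Equiv.addRight (Fin.ofNat m r))]
    simp only [Equiv.coe_addRight, hf, hpow, Finset.mul_sum]
    exact Finset.sum_congr rfl fun k _ => mul_left_comm _ _ _
  have hzero : (ε ^ r - 1) * ∑ k : Fin m, f k * ε ^ (k : ℕ) = 0 := by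
    rw [sub_mul, one_mul, ← hshift, sub_self]
  exact (mul_eq_zero.mp hzero).resolve_left (sub_ne_zero.mpr hr)

/-- The sum of a function over the images of a point under a group of permutations is unchanged
when the point is moved by an element of the group. -/
theorem Subgroup.sum_perm_apply_apply {α M : Type*} [AddCommMonoid M]
    (H : Subgroup (Equiv.Perm α)) [Fintype H] (f : α → M) (τ : H) (a : α) :
    ∑ σ : H, f (σ.1 (τ.1 a)) = ∑ σ : H, f (σ.1 a) :=
  Equiv.sum_comp (Equiv.mulRight τ) fun σ : H => f (σ.1 a)


/-- Let `m = d * r` (`d ≥ 2`, `r ≥ 1`), blocks of `Fin m` the residue classes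
mod `r`, `G ≤ Sym(Fin m)`, `ε` a primitive `m`-th root of unity, and `n` balanced w.r.t. `G`.
Fix `i₀ < r` and let `H` be the pointwise stabilizer in `G` of the block `B_{i₀}`; suppose
every element of `H` maps every block to itself and `H` acts transitively on each block
`B_i`, `i ≠ i₀`.  Then `∑_{k ∈ B_{i₀}} n_k ε^k = 0`, i.e. the restriction of `n` to
`B_{i₀}` is balanced. -/
theorem stmt_14 (m d r : ℕ) (hd : 2 ≤ d) (hr : 1 ≤ r) (hm : m = d * r)
    (G : Subgroup (Equiv.Perm (Fin m)))
    (ε : ℂ) (hε : IsPrimitiveRoot ε m) (n : Fin m → ℂ)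
    (hbal : ∀ σ ∈ G, ∑ k : Fin m, n (σ k) * ε ^ (k : ℕ) = 0)
    (i₀ : ℕ) (hi₀ : i₀ < r)
    (hblocks : ∀ σ ∈ G, (∀ k : Fin m, (k : ℕ) % r = i₀ → σ k = k) →
      ∀ k : Fin m, ((σ k : Fin m) : ℕ) % r = (k : ℕ) % r)
    (htrans : ∀ i < r, i ≠ i₀ → ∀ a b : Fin m, (a : ℕ) % r = i → (b : ℕ) % r = i →
      ∃ σ ∈ G, (∀ k : Fin m, (k : ℕ) % r = i₀ → σ k = k) ∧ σ a = b) :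
    ∑ k ∈ Finset.univ.filter (fun k : Fin m => (k : ℕ) % r = i₀), n k * ε ^ (k : ℕ) = 0 := by
  classical
  have hm_pos : 0 < m := hm ▸ Nat.mul_pos (by omega) hr
  have : NeZero m := ⟨hm_pos.ne'⟩
  have hr_lt : r < m := by nlinarith
  let H := G ⊓ fixingSubgroup (Equiv.Perm (Fin m)) {k : Fin m | (k : ℕ) % r = i₀}
  have hfix (σ : H) (k : Fin m) (hk : (k : ℕ) % r = i₀) : σ.1 k = k :=
    (mem_fixingSubgroup_iff _).mp σ.2.2 k hk
  have hmod (k : Fin m) : ((k + Fin.ofNat m r : Fin m) : ℕ) % r = (k : ℕ) % r := by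
    rw [Fin.val_add, Fin.val_ofNat, Nat.add_mod_mod, Nat.mod_mod_of_dvd _ (hm ▸ dvd_mul_left r d),
      Nat.add_mod_right]
  -- Outside the fixed block, the orbit sums over `H` are constant on residue classes.
  have houtside : ∑ k : Fin m,
      (if (k : ℕ) % r = i₀ then 0 else ∑ σ : H, n (σ.1 k)) * ε ^ (k : ℕ) = 0 := by
    refine sum_mul_pow_eq_zero_of_add_eq hε.pow_eq_one
      (hε.pow_ne_one_of_pos_of_lt (by omega) hr_lt) fun k => ?_
    rw [hmod]
    split_ifs with hk
    · rfl
    · obtain ⟨τ, hτG, hτ, hτk⟩ :=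
        htrans _ (Nat.mod_lt _ hr) hk k (k + Fin.ofNat m r) rfl (hmod k)
      rw [← hτk]
      exact H.sum_perm_apply_apply n ⟨τ, hτG, (mem_fixingSubgroup_iff _).mpr hτ⟩ k
  have htotal : ∑ k : Fin m, (∑ σ : H, n (σ.1 k)) * ε ^ (k : ℕ) = 0 := by
    simp_rw [Finset.sum_mul]
    rw [Finset.sum_comm]
    exact Finset.sum_eq_zero fun σ _ => hbal σ.1 σ.2.1
  have hcard : (Fintype.card H : ℂ) *
      ∑ k ∈ Finset.univ.filter (fun k : Fin m => (k : ℕ) % r = i₀), n k * ε ^ (k : ℕ) = 0 := by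
    rw [← sub_zero (0 : ℂ)]
    nth_rw 1 [← htotal]
    rw [← houtside, ← Finset.sum_sub_distrib, Finset.mul_sum, Finset.sum_filter]
    refine Finset.sum_congr rfl fun k _ => ?_
    split_ifs with hk
    · simp [hfix _ k hk, mul_assoc]
    · simp
  exact (mul_eq_zero.mp hcard).resolve_left (Nat.cast_ne_zero.mpr Fintype.card_ne_zero)
end
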